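/- arXiv:2101.02541 — 3 statements merged into one kernel-verified Lean document; each statement's English description precedes it below -/
import Mathlib

section
/- Let m ≥ 1, i ≥ 3 and 0 ≤ k ≤ i−1 be integers and set j = 3m. Let G be the simple graph on the vertex set (Fin j) × (ZMod i) whose edges are all edges of the twisted toroidal grid T(i,j,k) together with the diagonal edges {(b,a),(b+1,a+1)} for all a ∈ ZMod i and all b with 0 ≤ b ≤ j−2 and b ≡ 1 or 2 (mod 3), and the wrap-around diagonal edges {(j−1,a),(0,a+k+1)} for all a ∈ ZMod i. Then G has a Hamiltonian cycle. -/
/-- Extend a path along a row. -/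
lemma row_extend {i j : ℕ} (G : SimpleGraph (Fin j × ZMod i))
    (hrow : ∀ b a, G.Adj (b, a) (b, a + 1)) (b : Fin j) (s : ZMod i) (u : Fin j × ZMod i)
    (p : G.Walk u (b, s)) (hp : p.IsPath) (n : ℕ) (hn : n < i)
    (h : ∀ t : ℕ, 1 ≤ t → t ≤ n → (b, s - (t : ZMod i)) ∉ p.support) :
    ∃ q : G.Walk u (b, s - (n : ZMod i)), q.IsPath ∧
      ∀ v, v ∈ q.support ↔ v ∈ p.support ∨ ∃ t : ℕ, 1 ≤ t ∧ t ≤ n ∧ v = (b, s - (t : ZMod i)) := by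
  induction n with
  | zero =>
    have e : s - ((0 : ℕ) : ZMod i) = s := by simp
    rw [e]
    refine ⟨p, hp, fun v => ⟨Or.inl, ?_⟩⟩
    rintro (hv | ⟨t, h1, h2, -⟩)
    · exact hv
    · omega
  | succ n ih =>
    obtain ⟨q, hq, hs⟩ := ih (by omega) (fun t h1 h2 => h t h1 (by omega))
    have hadj : G.Adj (b, s - (n : ZMod i)) (b, s - ((n + 1 : ℕ) : ZMod i)) := by
      have := (hrow b (s - ((n + 1 : ℕ) : ZMod i))).symm
      have e : s - ((n + 1 : ℕ) : ZMod i) + 1 = s - (n : ZMod i) := by push_cast; ring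
      rwa [e] at this
    refine ⟨q.concat hadj, hq.concat ?_ hadj, fun v => ?_⟩
    · rw [hs]
      rintro (hv | ⟨t, h1, h2, h3⟩)
      · exact h (n + 1) (by omega) le_rfl hv
      · have h4 : ((n + 1 : ℕ) : ZMod i) = (t : ZMod i) := by
          simpa using (Prod.ext_iff.1 h3).2
        rw [ZMod.natCast_eq_natCast_iff', Nat.mod_eq_of_lt hn, Nat.mod_eq_of_lt (by omega)] at h4
        omega
    · rw [SimpleGraph.Walk.support_concat, List.mem_append, hs,
        List.mem_singleton]
      constructor
      · rintro ((hv | ⟨t, h1, h2, h3⟩) | hv)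
        · exact Or.inl hv
        · exact Or.inr ⟨t, h1, by omega, h3⟩
        · exact Or.inr ⟨n + 1, by omega, le_rfl, hv⟩
      · rintro (hv | ⟨t, h1, h2, h3⟩)
        · exact Or.inl (Or.inl hv)
        · rcases Nat.lt_or_ge n t with h4 | h4
          · obtain rfl : t = n + 1 := by omega
            exact Or.inr h3
          · exact Or.inl (Or.inr ⟨t, h1, h4, h3⟩)

/-- Hamiltonian path in the first rows with adjacent endpoints in the top row. -/
lemma cyl_path {i j : ℕ} (hi : 3 ≤ i) (G : SimpleGraph (Fin j × ZMod i))
    (hrow : ∀ b a, G.Adj (b, a) (b, a + 1))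
    (hcol : ∀ (b c : Fin j) a, (c : ℕ) = b + 1 → G.Adj (b, a) (c, a)) (n : ℕ) (hn : n < j) :
    ∃ (s : ZMod i) (p : G.Walk (⟨n, hn⟩, s) (⟨n, hn⟩, s + 1)), p.IsPath ∧
      ∀ v, v ∈ p.support ↔ (v.1 : ℕ) ≤ n := by
  have : NeZero i := ⟨by omega⟩
  have cover : ∀ s x : ZMod i, ∃ t : ℕ, t < i ∧ x = s - (t : ZMod i) := fun s x =>
    ⟨(s - x).val, ZMod.val_lt _, by simp⟩
  induction n with
  | zero =>
    have := row_extend G hrow ⟨0, hn⟩ 0 _ SimpleGraph.Walk.nil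
      SimpleGraph.Walk.IsPath.nil (i - 1) (by omega) (by
        intro t h1 h2 h3
        have h4 : (t : ZMod i) = 0 := by simpa using h3
        rw [ZMod.natCast_eq_zero_iff] at h4
        exact absurd (Nat.le_of_dvd (by omega) h4) (by omega))
    have e : (0 : ZMod i) - ((i - 1 : ℕ) : ZMod i) = 0 + 1 := by
      rw [Nat.cast_sub (by omega)]; simp
    rw [e] at this
    obtain ⟨q, hq, hs⟩ := this
    refine ⟨0, q, hq, fun v => ?_⟩
    rw [hs]
    constructor
    · rintro (h | ⟨t, -, -, rfl⟩)
      · rw [SimpleGraph.Walk.support_nil, List.mem_singleton] at h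
        simp [h]
      · simp
    · intro hv
      obtain ⟨c, x⟩ := v
      obtain rfl : c = ⟨0, hn⟩ := Fin.ext (by simp at *; omega)
      obtain ⟨t, ht, rfl⟩ := cover 0 x
      rcases Nat.eq_zero_or_pos t with rfl | h0
      · left; simp
      · exact Or.inr ⟨t, h0, by omega, rfl⟩
  | succ n ih =>
    obtain ⟨s, p, hp, hs⟩ := ih (by omega)
    have ha := hcol ⟨n, by omega⟩ ⟨n + 1, hn⟩ (s + 1) rfl
    have hb := hcol ⟨n, by omega⟩ ⟨n + 1, hn⟩ s rfl
    have e : s - ((i - 2 : ℕ) : ZMod i) = s + 1 + 1 := by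
      rw [Nat.cast_sub (by omega)]; simp; ring
    have hr : ((p.reverse).concat hb).IsPath :=
      hp.reverse.concat (by simp [hs]) hb
    have hone : (1 : ZMod i) ≠ 0 := by
      have : Fact (1 < i) := ⟨by omega⟩
      exact one_ne_zero
    have hc : (SimpleGraph.Walk.cons ha.symm ((p.reverse).concat hb)).IsPath :=
      hr.cons (by simp [SimpleGraph.Walk.support_concat, hs, hone])
    have hsup : ∀ v, v ∈ (SimpleGraph.Walk.cons ha.symm ((p.reverse).concat hb)).support ↔
        (v.1 : ℕ) ≤ n ∨ v = (⟨n + 1, hn⟩, s + 1) ∨ v = (⟨n + 1, hn⟩, s) := by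
      intro v
      simp [SimpleGraph.Walk.support_concat, hs]
      tauto
    have := row_extend G hrow ⟨n + 1, hn⟩ s _ _ hc (i - 2) (by omega) (by
        intro t h1 h2 h3
        rw [hsup] at h3
        rcases h3 with h3 | h3 | h3
        · simp at h3
        · have h4 : s - (t : ZMod i) = s + 1 := (Prod.ext_iff.1 h3).2
          have h5 : ((t + 1 : ℕ) : ZMod i) = 0 := by
            push_cast; linear_combination -h4
          rw [ZMod.natCast_eq_zero_iff] at h5
          exact absurd (Nat.le_of_dvd (by omega) h5) (by omega)
        · have h4 : s - (t : ZMod i) = s := (Prod.ext_iff.1 h3).2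
          have h5 : (t : ZMod i) = 0 := by linear_combination -h4
          rw [ZMod.natCast_eq_zero_iff] at h5
          exact absurd (Nat.le_of_dvd (by omega) h5) (by omega))
    rw [e] at this
    obtain ⟨q, hq, hqs⟩ := this
    refine ⟨s + 1, q, hq, fun v => ?_⟩
    rw [hqs, hsup]
    constructor
    · rintro ((h | rfl | rfl) | ⟨t, -, -, rfl⟩)
      · omega
      all_goals simp
    · intro hv
      rcases Nat.lt_or_ge n v.1 with h | h
      · obtain ⟨c, x⟩ := v
        obtain rfl : c = ⟨n + 1, hn⟩ := Fin.ext (by simp at *; omega)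
        obtain ⟨t, ht, rfl⟩ := cover s x
        rcases Nat.eq_zero_or_pos t with rfl | h0
        · left; right; right; simp
        · rcases Nat.lt_or_ge (i - 2) t with h1 | h1
          · left; right; left
            obtain rfl : t = i - 1 := by omega
            rw [Nat.cast_sub (by omega)]; simp
          · exact Or.inr ⟨t, h0, h1, rfl⟩
      · exact Or.inl (Or.inl h)


/-- The twisted toroidal grid `T(i,j,k)` on vertex set `Fin j × ZMod i`, with row edges
`{(b,a),(b,a+1)}`, vertical edges `{(b,a),(b+1,a)}` for `0 ≤ b < j-1`, and wrap-around
edges `{(j-1,a),(0,a+k)}`. -/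
def twistedGrid (i j k : ℕ) : SimpleGraph (Fin j × ZMod i) :=
  SimpleGraph.fromRel (fun p q =>
    (p.1 = q.1 ∧ q.2 = p.2 + 1) ∨
    ((q.1 : ℕ) = (p.1 : ℕ) + 1 ∧ q.2 = p.2) ∨
    ((p.1 : ℕ) = j - 1 ∧ (q.1 : ℕ) = 0 ∧ q.2 = p.2 + (k : ZMod i)))

/-- The edge graph of the doubly semi-equivelar map of type `[3⁶:3³.4²]₁` in its
`M(i,j,k)`-representation (`j = 3m`): the twisted toroidal grid together with diagonal
edges `{(b,a),(b+1,a+1)}` for rows `b ≡ 1, 2 (mod 3)` and the wrap-around diagonals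
`{(j-1,a),(0,a+k+1)}`, is Hamiltonian. -/
theorem dsem_3_6_3_3_4_2_1_hamiltonian (m i j k : ℕ) (hm : 1 ≤ m) (hj : j = 3 * m)
    (hi : 3 ≤ i) (hk : k ≤ i - 1) :
    ∃ (v : Fin j × ZMod i)
      (c : (twistedGrid i j k ⊔ SimpleGraph.fromRel (fun p q : Fin j × ZMod i =>
        (((p.1 : ℕ) % 3 = 1 ∨ (p.1 : ℕ) % 3 = 2) ∧ (q.1 : ℕ) = (p.1 : ℕ) + 1 ∧
          q.2 = p.2 + 1) ∨
        ((p.1 : ℕ) = j - 1 ∧ (q.1 : ℕ) = 0 ∧ q.2 = p.2 + (k : ZMod i) + 1))).Walk v v),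
      c.IsHamiltonianCycle := by
  have hone : (1 : ZMod i) ≠ 0 := by
    have : Fact (1 < i) := ⟨by omega⟩
    exact one_ne_zero
  have : NeZero i := ⟨by omega⟩
  generalize hG : (twistedGrid i j k ⊔ SimpleGraph.fromRel (fun p q : Fin j × ZMod i =>
        (((p.1 : ℕ) % 3 = 1 ∨ (p.1 : ℕ) % 3 = 2) ∧ (q.1 : ℕ) = (p.1 : ℕ) + 1 ∧
          q.2 = p.2 + 1) ∨
        ((p.1 : ℕ) = j - 1 ∧ (q.1 : ℕ) = 0 ∧ q.2 = p.2 + (k : ZMod i) + 1))) = G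
  have hrow : ∀ b a, G.Adj (b, a) (b, a + 1) := by
    intro b a
    rw [← hG]
    left
    rw [twistedGrid, SimpleGraph.fromRel_adj]
    exact ⟨by simp [hone], Or.inl (Or.inl ⟨rfl, rfl⟩)⟩
  have hcol : ∀ (b c : Fin j) a, (c : ℕ) = b + 1 → G.Adj (b, a) (c, a) := by
    intro b c a h
    rw [← hG]
    left
    rw [twistedGrid, SimpleGraph.fromRel_adj]
    refine ⟨?_, Or.inl (Or.inr (Or.inl ⟨h, rfl⟩))⟩
    intro h'
    have := congrArg Fin.val (Prod.ext_iff.1 h').1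
    simp at this
    omega
  have hn : j - 1 < j := by omega
  obtain ⟨s, p, hp, hs⟩ := cyl_path hi G hrow hcol (j - 1) hn
  have hH : p.IsHamiltonian := hp.isHamiltonian_of_mem (fun w => (hs w).2 (by have := w.1.2; omega))
  refine ⟨_, SimpleGraph.Walk.cons (hrow ⟨j - 1, hn⟩ s).symm p, ?_⟩
  refine ⟨?_, ?_⟩
  · rw [SimpleGraph.Walk.cons_isCycle_iff]
    refine ⟨hp, fun h => ?_⟩
    rw [Sym2.eq_swap] at h
    have h1 := hp.length_eq_one_of_mem_edges h
    have h2 := hH.length_eq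
    rw [Fintype.card_prod, Fintype.card_fin, ZMod.card, h1] at h2
    have : 3 * 3 ≤ j * i := Nat.mul_le_mul (by omega) hi
    omega
  · intro x
    simpa using hH x
end

section
/- Let i ≥ 6 be an even integer, let j ≥ 1 be an integer and let 0 ≤ k ≤ i−1. Let H(i,j,k) be the simple graph whose vertex set is the disjoint union of the set of y-vertices {y(s,a) : s ∈ Fin j, a ∈ ZMod i} and the set of x-vertices {x(s,t) : s ∈ Fin j, t ∈ Fin (i/2)}, and whose edges are: the row edges {y(s,a), y(s,a+1)} for all s and all a ∈ ZMod i; the edges {x(s,t), y(s,2t)} and {x(s,t), y(s,2t+1)} for all s and t; the edges {x(s,t), y(s+1,2t)} and {x(s,t), y(s+1,2t+1)} for all t and all s with 0 ≤ s < j−1; and the edges {x(j−1,t), y(0,2t+k)} and {x(j−1,t), y(0,2t+1+k)} for all t (all additions in ZMod i). Then H(i,j,k) has a Hamiltonian cycle. -/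
/-- The edge graph `H(i,j,k)` of the doubly semi-equivelar map of type `[3².6²:3.6.3.6]`
in its `M(i,j,k)`-representation.  The `y`-vertices `Sum.inl (s, a)` (with `s : Fin j`,
`a : ZMod i`) form `j` horizontal cycles of length `i`; the `x`-vertices `Sum.inr (s, t)`
(with `t : Fin (i/2)`) sit between consecutive horizontal cycles: `x(s,t)` is adjacent
to `y(s,2t)`, `y(s,2t+1)`, `y(s+1,2t)`, `y(s+1,2t+1)` (for `s < j-1`), and `x(j-1,t)` is
adjacent to `y(0,2t+k)` and `y(0,2t+1+k)`. -/
def Hgraph (i j k : ℕ) : SimpleGraph ((Fin j × ZMod i) ⊕ (Fin j × Fin (i / 2))) :=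
  SimpleGraph.fromRel (fun p q =>
    match p, q with
    | Sum.inl (s, a), Sum.inl (s', a') => s = s' ∧ a' = a + 1
    | Sum.inr (s, t), Sum.inl (s', a) =>
        (s = s' ∧ (a = ((2 * (t : ℕ) : ℕ) : ZMod i) ∨ a = ((2 * (t : ℕ) + 1 : ℕ) : ZMod i))) ∨
        ((s' : ℕ) = (s : ℕ) + 1 ∧
          (a = ((2 * (t : ℕ) : ℕ) : ZMod i) ∨ a = ((2 * (t : ℕ) + 1 : ℕ) : ZMod i))) ∨
        ((s : ℕ) = j - 1 ∧ (s' : ℕ) = 0 ∧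
          (a = ((2 * (t : ℕ) : ℕ) : ZMod i) + (k : ZMod i) ∨
           a = ((2 * (t : ℕ) + 1 : ℕ) : ZMod i) + (k : ZMod i)))
    | _, _ => False)

namespace HgraphAux

abbrev V (i j : ℕ) := (Fin j × ZMod i) ⊕ (Fin j × Fin (i / 2))

/-- the `y`-vertex with natural number index -/
def Y (i j : ℕ) (s : Fin j) (n : ℕ) : V i j := Sum.inl (s, (n : ZMod i))

/-- the `x`-vertex with natural number index modulo `i / 2` -/
def X (i j : ℕ) (h : 0 < i / 2) (s : Fin j) (n : ℕ) : V i j :=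
  Sum.inr (s, ⟨n % (i / 2), Nat.mod_lt _ h⟩)

/-- the row of a vertex -/
def row {i j : ℕ} : V i j → ℕ
  | Sum.inl (s, _) => s
  | Sum.inr (s, _) => s

/-- there is a walk from `u` to `v` with `n` vertices covering `S` -/
def Route {V : Type*} (G : SimpleGraph V) (u v : V) (n : ℕ) (S : V → Prop) : Prop :=
  ∃ p : G.Walk u v, p.length + 1 = n ∧ ∀ w, S w → w ∈ p.support

section general
variable {V : Type*} {G : SimpleGraph V} {u v v' w : V} {n n' : ℕ} {S S' T : V → Prop}

theorem Route.single (u : V) : Route G u u 1 (fun w => w = u) :=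
  ⟨.nil, by simp⟩

theorem Route.join (h : Route G u v n S) (e : G.Adj v v') (h' : Route G v' w n' S') :
    Route G u w (n + n') (fun x => S x ∨ S' x) := by
  obtain ⟨p, hp, hS⟩ := h
  obtain ⟨q, hq, hS'⟩ := h'
  refine ⟨p.append (.cons e q), ?_, ?_⟩
  · simp; omega
  · intro x hx
    rw [SimpleGraph.Walk.mem_support_append_iff]
    rcases hx with hx | hx
    · exact Or.inl (hS _ hx)
    · right; simp [hS' _ hx]

theorem Route.rev (h : Route G u v n S) : Route G v u n S := by
  obtain ⟨p, hp, hS⟩ := h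
  exact ⟨p.reverse, by simpa using hp, by simpa using hS⟩

theorem Route.mono (h : Route G u v n S) (e : n = n') (hST : ∀ w, T w → S w) :
    Route G u v n' T := by
  obtain ⟨p, hp, hS⟩ := h
  exact ⟨p, by omega, fun w hw => hS w (hST w hw)⟩

theorem Route.hamiltonian [DecidableEq V] [Fintype V] (h : Route G u v n (fun _ => True))
    (hn : n = Fintype.card V) (h3 : 3 ≤ n) (e : G.Adj v u) :
    ∃ (v : V) (c : G.Walk v v), c.IsHamiltonianCycle := by
  obtain ⟨p, hp, hS⟩ := h
  have hpath : p.IsPath := by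
    rw [SimpleGraph.Walk.isPath_def]
    have h1 : p.support.toFinset = Finset.univ := by
      ext w; simp [hS w trivial]
    rw [← Multiset.coe_nodup, ← Multiset.toFinset_card_eq_card_iff_nodup]
    simp only [Multiset.coe_card, SimpleGraph.Walk.length_support]
    have : (p.support : Multiset V).toFinset = Finset.univ := h1
    rw [this, Finset.card_univ]; omega
  refine ⟨v, .cons e p, ?_⟩
  rw [SimpleGraph.Walk.isHamiltonianCycle_iff_isCycle_and_length_eq]
  refine ⟨?_, by simp; omega⟩
  rw [SimpleGraph.Walk.cons_isCycle_iff]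
  refine ⟨hpath, fun hmem => ?_⟩
  rw [Sym2.eq_swap] at hmem
  have := hpath.length_eq_one_of_mem_edges hmem
  omega

end general

section graph
variable {i j k : ℕ}

theorem Y_adj (hi : 6 ≤ i) (s : Fin j) (n : ℕ) :
    (Hgraph i j k).Adj (Y i j s (n + 1)) (Y i j s n) := by
  have : Fact (1 < i) := ⟨by omega⟩
  simp [Hgraph, Y]

theorem cast_mod (hie : Even i) (n : ℕ) : ((2 * (n % (i / 2)) : ℕ) : ZMod i) = ((2 * n : ℕ) : ZMod i) := by
  rw [ZMod.natCast_eq_natCast_iff]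
  obtain ⟨m, rfl⟩ := hie
  have : (m + m) / 2 = m := by omega
  rw [this, ← two_mul]
  exact (Nat.mod_modEq n m).mul_left' 2

theorem X_adj0 (h : 0 < i / 2) (hie : Even i) (s s' : Fin j) (hs : s' = s ∨ (s' : ℕ) = s + 1)
    (n : ℕ) : (Hgraph i j k).Adj (X i j h s n) (Y i j s' (2 * n)) := by
  have := cast_mod hie n
  push_cast at this
  rcases hs with rfl | hs <;> simp [Hgraph, X, Y, *]

theorem X_adj1 (h : 0 < i / 2) (hie : Even i) (s s' : Fin j) (hs : s' = s ∨ (s' : ℕ) = s + 1)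
    (n : ℕ) : (Hgraph i j k).Adj (X i j h s n) (Y i j s' (2 * n + 1)) := by
  have := cast_mod hie n
  push_cast at this
  rcases hs with rfl | hs <;> simp [Hgraph, X, Y, *]

/-- the vertices of row `s` in blocks `a, …, b` -/
def Blk (i j : ℕ) (h : 0 < i / 2) (s : Fin j) (a b : ℕ) (w : V i j) : Prop :=
  ∃ n, a ≤ n ∧ n ≤ b ∧ (w = Y i j s (2 * n + 1) ∨ w = X i j h s n ∨ w = Y i j s (2 * n))

theorem blocks (hi : 6 ≤ i) (h : 0 < i / 2) (hie : Even i) (s : Fin j) (a r : ℕ) :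
    Route (Hgraph i j k) (Y i j s (2 * (a + r) + 1)) (Y i j s (2 * a)) (3 * (r + 1))
      (Blk i j h s a (a + r)) := by
  have one : ∀ n, Route (Hgraph i j k) (Y i j s (2 * n + 1)) (Y i j s (2 * n)) 3
      (Blk i j h s n n) := by
    intro n
    refine (((Route.single (Y i j s (2 * n + 1))).join (X_adj1 h hie s s (.inl rfl) n).symm
      (Route.single _)).join (X_adj0 h hie s s (.inl rfl) n) (Route.single _)).mono rfl ?_
    rintro w ⟨l, h1, h2, h3⟩
    obtain rfl : l = n := by omega
    tauto
  induction r with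
  | zero => exact one a
  | succ r ih =>
    refine ((one (a + (r + 1))).join (Y_adj hi s (2 * (a + r) + 1)) ih).mono (by ring) ?_
    rintro w ⟨l, h1, h2, h3⟩
    rcases Nat.lt_or_ge l (a + r + 1) with h4 | h4
    · exact .inr ⟨l, h1, by omega, h3⟩
    · exact .inl ⟨l, by omega, by omega, h3⟩

theorem exists_rep (m c t : ℕ) (hm : 0 < m) :
    ∃ n, c + 1 ≤ n ∧ n ≤ c + m ∧ n % m = t % m := by
  have h1 := Nat.mod_lt (t + m * (c + 1) - (c + 1)) hm
  refine ⟨c + 1 + (t + m * (c + 1) - (c + 1)) % m, by omega, by omega, ?_⟩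
  have h2 : c + 1 ≤ m * (c + 1) := Nat.le_mul_of_pos_left _ hm
  rw [Nat.add_mod_mod]
  have : c + 1 + (t + m * (c + 1) - (c + 1)) = t + m * (c + 1) := by omega
  rw [this, Nat.add_mul_mod_self_left]

theorem cover (hi : 6 ≤ i) (h : 0 < i / 2) (hie : Even i) (s : Fin j) (c : ℕ) (w : V i j)
    (hw : row w = s) : Blk i j h s (c + 1) (c + i / 2) w := by
  have : NeZero i := ⟨by omega⟩
  rcases w with ⟨s', a⟩ | ⟨s', t⟩
  · obtain rfl : s' = s := Fin.ext hw
    obtain ⟨n, h1, h2, h3⟩ := exists_rep (i / 2) c (a.val / 2) h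
    refine ⟨n, h1, h2, ?_⟩
    have key : ((2 * n : ℕ) : ZMod i) = ((2 * (a.val / 2) : ℕ) : ZMod i) := by
      rw [← cast_mod hie, h3, cast_mod hie]
    have ha : ((a.val : ℕ) : ZMod i) = a := ZMod.natCast_zmod_val a
    rcases Nat.even_or_odd' a.val with ⟨b, hb | hb⟩
    · right; right
      have e : 2 * (a.val / 2) = a.val := by omega
      rw [Y, key, e, ha]
    · left
      have e : 2 * (a.val / 2) + 1 = a.val := by omega
      rw [Y, Nat.cast_succ, key, ← Nat.cast_succ, Nat.succ_eq_add_one, e, ha]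
  · obtain rfl : s' = s := Fin.ext hw
    obtain ⟨n, h1, h2, h3⟩ := exists_rep (i / 2) c t h
    refine ⟨n, h1, h2, .inr (.inl ?_)⟩
    rw [Nat.mod_eq_of_lt t.2] at h3
    simp [X, h3]

theorem main (hi : 6 ≤ i) (h : 0 < i / 2) (hie : Even i) (d : ℕ) :
    ∀ (s : Fin j) (c : ℕ), (s : ℕ) + d + 1 = j →
    Route (Hgraph i j k) (Y i j s (2 * (c + i / 2) + 1)) (Y i j s (2 * c + 2))
      (3 * (i / 2) * (d + 1)) (fun w => (s : ℕ) ≤ row w) := by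
  induction d with
  | zero =>
    intro s c hs
    have := blocks (k := k) hi h hie s (c + 1) (i / 2 - 1)
    rw [show c + 1 + (i / 2 - 1) = c + i / 2 by omega] at this
    refine this.mono (by rw [Nat.sub_add_cancel h]; ring) fun w hw => cover hi h hie s c w ?_
    have : row w < j := by rcases w with ⟨a, b⟩ | ⟨a, b⟩ <;> exact a.2
    omega
  | succ d ih =>
    intro s c hs
    have hs1 : (s : ℕ) + 1 < j := by omega
    have up := (ih ⟨s + 1, hs1⟩ (c + 1) (by simp; omega)).rev
    have e1 : Y i j ⟨s + 1, hs1⟩ (2 * (c + 1 + i / 2) + 1) = Y i j ⟨s + 1, hs1⟩ (2 * (c + 1) + 1) := by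
      have : 2 * (c + 1 + i / 2) + 1 = 2 * (c + 1) + 1 + i := by
        have := Nat.two_mul_div_two_of_even hie
        omega
      rw [Y, this]; simp [Y]
    rw [e1] at up
    have b := blocks (k := k) hi h hie s (c + 3) (i / 2 - 3)
    rw [show c + 3 + (i / 2 - 3) = c + i / 2 by omega] at b
    have r := ((((((b.join (Y_adj hi s (2 * (c + 2) + 1)) (Route.single _)).join
      (Y_adj hi s (2 * (c + 2))) (Route.single _)).join
      (X_adj0 h hie s s (.inl rfl) (c + 2)).symm (Route.single _)).join
      (X_adj0 h hie s _ (.inr rfl) (c + 2)) up).join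
      (X_adj1 h hie s _ (.inr rfl) (c + 1)).symm (Route.single _)).join
      (X_adj1 h hie s s (.inl rfl) (c + 1)) (Route.single _)).join
      (Y_adj hi s (2 * (c + 1))) (Route.single _)
    refine r.mono ?_ ?_
    · have : 3 * (i / 2 - 3 + 1) + 6 = 3 * (i / 2) := by omega
      rw [mul_add (3 * (i / 2)) (d + 1) 1]
      omega
    · intro w hw
      rcases Nat.eq_or_lt_of_le hw with hw | hw
      · obtain ⟨n, h1, h2, h3⟩ := cover hi h hie s c w hw.symm
        rcases (show n = c + 1 ∨ n = c + 2 ∨ c + 3 ≤ n by omega) with rfl | rfl | h4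
        · tauto
        · tauto
        · have : Blk i j h s (c + 3) (c + i / 2) w := ⟨n, h4, h2, h3⟩
          tauto
      · have : s + 1 ≤ row w := hw
        tauto

end graph

end HgraphAux

/-- For every even `i ≥ 6`, `j ≥ 1` and `0 ≤ k ≤ i-1`, the graph `H(i,j,k)` has a
Hamiltonian cycle (Lemma 3.4.2 of the paper). -/
theorem Hgraph_hamiltonian (i j k : ℕ) (hi : 6 ≤ i) (hie : Even i) (hj : 1 ≤ j)
    (hk : k ≤ i - 1) :
    ∃ (v : (Fin j × ZMod i) ⊕ (Fin j × Fin (i / 2))) (c : (Hgraph i j k).Walk v v),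
      c.IsHamiltonianCycle := by
  classical
  have h : 0 < i / 2 := by omega
  have : NeZero i := ⟨by omega⟩
  have r := HgraphAux.main (k := k) hi h hie (j - 1) (⟨0, hj⟩ : Fin j) 0 (by simp; omega)
  have e1 : HgraphAux.Y i j ⟨0, hj⟩ (2 * (0 + i / 2) + 1) = HgraphAux.Y i j ⟨0, hj⟩ 1 := by
    have : 2 * (0 + i / 2) + 1 = 1 + i := by
      have := Nat.two_mul_div_two_of_even hie
      omega
    rw [HgraphAux.Y, this]; simp [HgraphAux.Y]
  rw [e1, Nat.sub_add_cancel hj] at r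
  have r' := r.mono (T := fun _ => True) rfl (fun w _ => Nat.zero_le _)
  obtain ⟨v, c, hc⟩ := r'.hamiltonian (by
    have := Nat.two_mul_div_two_of_even hie
    simp only [Fintype.card_sum, Fintype.card_prod, Fintype.card_fin, ZMod.card]
    nlinarith) (by nlinarith) (HgraphAux.Y_adj hi _ 1)
  refine ⟨v, c, ?_⟩
  convert hc
end

section
/- Let i ≥ 6 be an even integer, let j ≥ 2 be an even integer and let 0 ≤ k ≤ i−1. Let K(i,j,k) be the simple graph whose vertex set is the disjoint union of the set of y-vertices {y(s,a) : s ∈ Fin j, a ∈ ZMod i} and the set of x-vertices {x(s,t) : s ∈ Fin (j/2), t ∈ Fin (i/2)}, and whose edges are: the row edges {y(s,a), y(s,a+1)} for all s ∈ Fin j and a ∈ ZMod i; the edges {x(s,t), y(2s,2t)}, {x(s,t), y(2s,2t+1)}, {x(s,t), y(2s+1,2t)} and {x(s,t), y(2s+1,2t+1)} for all s ∈ Fin (j/2) and t ∈ Fin (i/2); the vertical edges {y(2s+1,a), y(2s+2,a)} for all a and all s with 2s+2 ≤ j−1; and the wrap-around vertical edges {y(j−1,a), y(0,a+k)} for all a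 (all additions in ZMod i). Then K(i,j,k) has a Hamiltonian cycle. -/
/-- The edge graph `K(i,j,k)` of the doubly semi-equivelar map of type `[3.4².6:3.6.3.6]`
in its `M(i,j,k)`-representation.  The `y`-vertices `Sum.inl (s, a)` (with `s : Fin j`,
`a : ZMod i`) form `j` horizontal cycles of length `i`; the `x`-vertices `Sum.inr (s, t)`
(with `s : Fin (j/2)`, `t : Fin (i/2)`) sit between the horizontal cycles `2s` and `2s+1`,
`x(s,t)` being adjacent to `y(2s,2t)`, `y(2s,2t+1)`, `y(2s+1,2t)` and `y(2s+1,2t+1)`;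
between cycles `2s+1` and `2s+2` every vertex is joined vertically to the vertex above it,
and `y(j-1,a)` is joined to `y(0,a+k)`. -/
def Kgraph (i j k : ℕ) : SimpleGraph ((Fin j × ZMod i) ⊕ (Fin (j / 2) × Fin (i / 2))) :=
  SimpleGraph.fromRel (fun p q =>
    match p, q with
    | Sum.inl (s, a), Sum.inl (s', a') =>
        (s = s' ∧ a' = a + 1) ∨
        ((s : ℕ) % 2 = 1 ∧ (s' : ℕ) = (s : ℕ) + 1 ∧ a' = a) ∨
        ((s : ℕ) = j - 1 ∧ (s' : ℕ) = 0 ∧ a' = a + (k : ZMod i))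
    | Sum.inr (s, t), Sum.inl (s', a) =>
        ((s' : ℕ) = 2 * (s : ℕ) ∨ (s' : ℕ) = 2 * (s : ℕ) + 1) ∧
        (a = ((2 * (t : ℕ) : ℕ) : ZMod i) ∨ a = ((2 * (t : ℕ) + 1 : ℕ) : ZMod i))
    | _, _ => False)

/-- A walk from `u` to `v` with `n` vertices (with multiplicity) covering `S`. -/
def Cov {V : Type*} (G : SimpleGraph V) (u v : V) (n : ℕ) (S : Set V) : Prop :=
  ∃ p : G.Walk u v, p.length + 1 = n ∧ ∀ w ∈ S, w ∈ p.support

theorem Cov.single {V : Type*} (G : SimpleGraph V) (u : V) : Cov G u u 1 {u} :=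
  ⟨SimpleGraph.Walk.nil, by simp, by simp⟩

theorem Cov.join {V : Type*} {G : SimpleGraph V} {u v w z : V} {n m : ℕ} {S T : Set V}
    (h1 : Cov G u v n S) (h : G.Adj v w) (h2 : Cov G w z m T) :
    Cov G u z (n + m) (S ∪ T) := by
  obtain ⟨p, hp, hS⟩ := h1
  obtain ⟨q, hq, hT⟩ := h2
  refine ⟨p.append (SimpleGraph.Walk.cons h q), ?_, ?_⟩
  · simp only [SimpleGraph.Walk.length_append, SimpleGraph.Walk.length_cons]
    omega
  · rintro x (hx | hx)
    · simp [SimpleGraph.Walk.mem_support_append_iff, hS x hx]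
    · simp [SimpleGraph.Walk.mem_support_append_iff, hT x hx]

theorem Cov.symm {V : Type*} {G : SimpleGraph V} {u v : V} {n : ℕ} {S : Set V}
    (h1 : Cov G u v n S) : Cov G v u n S := by
  obtain ⟨p, hp, hS⟩ := h1
  exact ⟨p.reverse, by simpa using hp, by simpa using hS⟩

theorem Cov.mono {V : Type*} {G : SimpleGraph V} {u v : V} {n n' : ℕ} {S T : Set V}
    (h1 : Cov G u v n S) (hn : n = n') (h : T ⊆ S) : Cov G u v n' T := by
  obtain ⟨p, hp, hS⟩ := h1
  exact ⟨p, hn ▸ hp, fun w hw => hS w (h hw)⟩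

theorem Cov.hamiltonian {V : Type*} [Fintype V] [DecidableEq V] {G : SimpleGraph V} {u v : V}
    (h : Cov G u v (Fintype.card V) Set.univ) (hV : 3 ≤ Fintype.card V) (ha : G.Adj v u) :
    ∃ (v : V) (c : G.Walk v v), c.IsHamiltonianCycle := by
  obtain ⟨p, hp, hS⟩ := h
  have hnd : p.support.Nodup := by
    have h1 : p.support.toFinset = Finset.univ := by
      ext w
      simp [hS w (Set.mem_univ w)]
    have h2 : p.support.toFinset.card = p.support.length := by
      rw [h1, SimpleGraph.Walk.length_support, hp, Finset.card_univ]
    exact Multiset.toFinset_card_eq_card_iff_nodup.mp h2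
  have hpath : p.IsPath := SimpleGraph.Walk.IsPath.mk' hnd
  refine ⟨v, SimpleGraph.Walk.cons ha p, ?_⟩
  rw [SimpleGraph.Walk.isHamiltonianCycle_iff_isCycle_and_length_eq]
  refine ⟨?_, by simpa using hp⟩
  rw [SimpleGraph.Walk.cons_isCycle_iff]
  refine ⟨hpath, fun he => ?_⟩
  have := hpath.length_eq_one_of_mem_edges (Sym2.eq_swap ▸ he)
  omega

section abstract_graph

variable {V : Type*} {G : SimpleGraph V} {Y X : ℕ → ℕ → V} {n m : ℕ}

theorem cov_low (s : ℕ) (h1 : ∀ a, G.Adj (Y (2 * s) a) (Y (2 * s) (a + 1)))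
    (hx : ∀ t < m, ∀ f < 2, G.Adj (X s t) (Y (2 * s) (2 * t + f))) (r : ℕ) (hr : r + 2 ≤ m) :
    Cov G (Y (2 * s) 2) (Y (2 * s) (3 + 2 * r)) (2 + 3 * r)
      ({w | ∃ a, 2 ≤ a ∧ a ≤ 3 + 2 * r ∧ w = Y (2 * s) a} ∪
        {w | ∃ t, 2 ≤ t ∧ t ≤ 1 + r ∧ w = X s t}) := by
  induction r with
  | zero =>
    refine ((Cov.single G _).join (h1 2) (Cov.single G _)).mono rfl ?_
    rintro w (⟨a, ha, hb, rfl⟩ | ⟨t, ha, hb, rfl⟩)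
    · obtain rfl | rfl : a = 2 ∨ a = 3 := by omega
      · simp
      · simp
    · omega
  | succ r ih =>
    have e1 := hx (r + 2) (by omega) 0 (by omega)
    have e2 := hx (r + 2) (by omega) 1 (by omega)
    have e0 := h1 (3 + 2 * r)
    rw [show 3 + 2 * r + 1 = 2 * (r + 2) + 0 by ring] at e0
    have := (((ih (by omega)).join e0 (Cov.single G _)).join e1.symm (Cov.single G _)).join e2
      (Cov.single G _)
    rw [show 3 + 2 * (r + 1) = 2 * (r + 2) + 1 by ring]
    refine this.mono (by ring) ?_
    rintro w (⟨a, ha, hb, rfl⟩ | ⟨t, ha, hb, rfl⟩)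
    · obtain h | rfl | rfl : a ≤ 3 + 2 * r ∨ a = 2 * (r + 2) + 0 ∨ a = 2 * (r + 2) + 1 := by omega
      · exact Or.inl (Or.inl (Or.inl (Or.inl ⟨a, ha, h, rfl⟩)))
      · exact Or.inl (Or.inl (Or.inr rfl))
      · exact Or.inr rfl
    · obtain h | rfl : t ≤ 1 + r ∨ t = r + 2 := by omega
      · exact Or.inl (Or.inl (Or.inl (Or.inr ⟨t, ha, h, rfl⟩)))
      · exact Or.inl (Or.inr rfl)

theorem cov_up (s : ℕ) (h1 : ∀ a, G.Adj (Y s a) (Y s (a + 1))) (r : ℕ) :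
    Cov G (Y s 2) (Y s (2 + r)) (r + 1) {w | ∃ a, 2 ≤ a ∧ a ≤ 2 + r ∧ w = Y s a} := by
  induction r with
  | zero =>
    refine (Cov.single G _).mono rfl ?_
    rintro w ⟨a, ha, hb, rfl⟩
    obtain rfl : a = 2 := by omega
    rfl
  | succ r ih =>
    refine (ih.join (h1 _) (Cov.single G _)).mono rfl ?_
    rintro w ⟨a, ha, hb, rfl⟩
    obtain h | rfl : a ≤ 2 + r ∨ a = 2 + r + 1 := by omega
    · exact Or.inl ⟨a, ha, h, rfl⟩
    · exact Or.inr rfl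

/-- The vertices of the long path in band `s`. -/
def bandB (Y X : ℕ → ℕ → V) (m s : ℕ) : Set V :=
  {w | ∃ e a, e < 2 ∧ a < 2 * m ∧ a ≠ 1 ∧ w = Y (2 * s + e) a} ∪
    {w | ∃ t, 1 ≤ t ∧ t < m ∧ w = X s t}

/-- The vertices of the short path in band `s`. -/
def bandA (Y X : ℕ → ℕ → V) (s : ℕ) : Set V :=
  {w | ∃ e, e < 2 ∧ w = Y (2 * s + e) 1} ∪ {X s 0}

theorem cov_bandB (hm : 2 ≤ m) (s : ℕ)
    (h1 : ∀ e < 2, ∀ a, G.Adj (Y (2 * s + e) a) (Y (2 * s + e) (a + 1)))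
    (hw : ∀ e < 2, Y (2 * s + e) (2 * m) = Y (2 * s + e) 0)
    (hx : ∀ t < m, ∀ e < 2, ∀ f < 2, G.Adj (X s t) (Y (2 * s + e) (2 * t + f))) :
    Cov G (Y (2 * s) 0) (Y (2 * s + 1) 0) (5 * m - 3) (bandB Y X m s) := by
  obtain ⟨r, rfl⟩ : ∃ r, m = r + 2 := ⟨m - 2, by omega⟩
  have a1 := h1 0 (by omega) (3 + 2 * r)
  rw [show 3 + 2 * r + 1 = 2 * (r + 2) by ring, hw 0 (by omega)] at a1
  have a2 := h1 1 (by omega) (2 + (2 * r + 1))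
  rw [show 2 + (2 * r + 1) + 1 = 2 * (r + 2) by ring, hw 1 (by omega)] at a2
  have l := cov_low s (h1 0 (by omega)) (fun t ht => hx t ht 0 (by omega)) r (le_refl _)
  have u := cov_up (2 * s + 1) (h1 1 (by omega)) (2 * r + 1)
  have x0 := hx 1 (by omega) 0 (by omega) 0 (by omega)
  have x1 := hx 1 (by omega) 1 (by omega) 0 (by omega)
  refine (((((Cov.single G _).join a1.symm l.symm).join x0.symm (Cov.single G _)).join x1 u).join a2
    (Cov.single G _)).mono (by omega) ?_
  rintro w (⟨e, a, he, ha, ha1, rfl⟩ | ⟨t, ha, hb, rfl⟩)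
  · obtain rfl | rfl : e = 0 ∨ e = 1 := by omega
    · obtain rfl | h : a = 0 ∨ 2 ≤ a := by omega
      · exact Or.inl (Or.inl (Or.inl (Or.inl rfl)))
      · exact Or.inl (Or.inl (Or.inl (Or.inr (Or.inl ⟨a, h, by omega, rfl⟩))))
    · obtain rfl | h : a = 0 ∨ 2 ≤ a := by omega
      · exact Or.inr rfl
      · exact Or.inl (Or.inr ⟨a, h, by omega, rfl⟩)
  · obtain rfl | h : t = 1 ∨ 2 ≤ t := by omega
    · exact Or.inl (Or.inl (Or.inr rfl))
    · exact Or.inl (Or.inl (Or.inl (Or.inr (Or.inr ⟨t, h, by omega, rfl⟩))))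

theorem cov_bandA (hm : 2 ≤ m) (s : ℕ)
    (hx : ∀ t < m, ∀ e < 2, ∀ f < 2, G.Adj (X s t) (Y (2 * s + e) (2 * t + f))) :
    Cov G (Y (2 * s) 1) (Y (2 * s + 1) 1) 3 (bandA Y X s) := by
  have x0 := hx 0 (by omega) 0 (by omega) 1 (by omega)
  have x1 := hx 0 (by omega) 1 (by omega) 1 (by omega)
  refine (((Cov.single G _).join x0.symm (Cov.single G _)).join x1 (Cov.single G _)).mono rfl ?_
  rintro w (⟨e, he, rfl⟩ | rfl)
  · obtain rfl | rfl : e = 0 ∨ e = 1 := by omega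
    · exact Or.inl (Or.inl rfl)
    · exact Or.inr rfl
  · exact Or.inl (Or.inr rfl)

theorem cov_stack (b c : ℕ) (B : ℕ → Set V)
    (hB : ∀ s < n, Cov G (Y (2 * s) b) (Y (2 * s + 1) b) c (B s))
    (hv : ∀ s, s + 1 < n → G.Adj (Y (2 * s + 1) b) (Y (2 * s + 2) b)) (r : ℕ) (hr : r < n) :
    Cov G (Y 0 b) (Y (2 * r + 1) b) (c * (r + 1)) {w | ∃ s, s ≤ r ∧ w ∈ B s} := by
  induction r with
  | zero =>
    refine (hB 0 hr).mono (by ring) ?_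
    rintro w ⟨s, hs, hw⟩
    obtain rfl : s = 0 := by omega
    exact hw
  | succ r ih =>
    refine ((ih (by omega)).join (hv r hr) (hB (r + 1) hr)).mono (by ring) ?_
    rintro w ⟨s, hs, hw⟩
    obtain h | rfl : s ≤ r ∨ s = r + 1 := by omega
    · exact Or.inl ⟨s, h, hw⟩
    · exact Or.inr hw

theorem abstract_hamiltonian [Fintype V] [DecidableEq V] (hm : 3 ≤ m) (hn : 1 ≤ n)
    (hcard : Fintype.card V = 2 * n * (2 * m) + n * m)
    (hcov : ∀ w : V, (∃ s a, s < 2 * n ∧ a < 2 * m ∧ w = Y s a) ∨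
      (∃ s t, s < n ∧ t < m ∧ w = X s t))
    (h1 : ∀ s < 2 * n, ∀ a, G.Adj (Y s a) (Y s (a + 1)))
    (hw : ∀ s < 2 * n, Y s (2 * m) = Y s 0)
    (hx : ∀ s < n, ∀ t < m, ∀ e < 2, ∀ f < 2, G.Adj (X s t) (Y (2 * s + e) (2 * t + f)))
    (hv : ∀ s, s + 1 < n → ∀ a, G.Adj (Y (2 * s + 1) a) (Y (2 * s + 2) a)) :
    ∃ (v : V) (c : G.Walk v v), c.IsHamiltonianCycle := by
  obtain ⟨r, rfl⟩ : ∃ r, n = r + 1 := ⟨n - 1, by omega⟩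
  have hB := cov_stack 0 _ (bandB Y X m) (fun s hs => cov_bandB (by omega) s
    (fun e he => h1 _ (by omega)) (fun e he => hw _ (by omega)) (hx s hs))
    (fun s hs => hv s hs 0) r (by omega)
  have hA := cov_stack 1 _ (bandA Y X) (fun s hs => cov_bandA (by omega) s (hx s hs))
    (fun s hs => hv s hs 1) r (by omega)
  have key := hA.join (h1 (2 * r + 1) (by omega) 0).symm hB.symm
  refine (key.mono (n' := Fintype.card V) (T := Set.univ) ?_ ?_).hamiltonian ?_ (h1 0 (by omega) 0)
  · obtain ⟨q, rfl⟩ : ∃ q, m = q + 1 := ⟨m - 1, by omega⟩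
    rw [hcard, show 5 * (q + 1) - 3 = 5 * q + 2 by omega]
    ring
  · rintro w -
    obtain ⟨s, a, hs, ha, rfl⟩ | ⟨s, t, hs, ht, rfl⟩ := hcov w
    · have e : s = 2 * (s / 2) + s % 2 := by omega
      by_cases h : a = 1
      · subst h
        exact Or.inl ⟨s / 2, by omega, Or.inl ⟨s % 2, by omega, by rw [← e]⟩⟩
      · exact Or.inr ⟨s / 2, by omega, Or.inl ⟨s % 2, a, by omega, ha, h, by rw [← e]⟩⟩
    · by_cases h : t = 0
      · subst h
        exact Or.inl ⟨s, by omega, Or.inr rfl⟩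
      · exact Or.inr ⟨s, by omega, Or.inr ⟨t, by omega, ht, rfl⟩⟩
  · rw [hcard]
    nlinarith

end abstract_graph

/-- For every even `i ≥ 6`, every even `j ≥ 2` and `0 ≤ k ≤ i-1`, the graph `K(i,j,k)`
has a Hamiltonian cycle (Lemma 3.3.2 of the paper). -/
theorem Kgraph_hamiltonian (i j k : ℕ) (hi : 6 ≤ i) (hie : Even i) (hj : 2 ≤ j)
    (hje : Even j) (hk : k ≤ i - 1) :
    ∃ (v : (Fin j × ZMod i) ⊕ (Fin (j / 2) × Fin (i / 2))) (c : (Kgraph i j k).Walk v v),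
      c.IsHamiltonianCycle := by
  obtain ⟨m, rfl⟩ : ∃ m, i = 2 * m := hie.exists_two_nsmul _ |>.imp (by simp)
  obtain ⟨n, rfl⟩ : ∃ n, j = 2 * n := hje.exists_two_nsmul _ |>.imp (by simp)
  have hm : 2 * m / 2 = m := by omega
  have hn : 2 * n / 2 = n := by omega
  have : NeZero (2 * m) := ⟨by omega⟩
  have : NeZero (2 * n) := ⟨by omega⟩
  have : NeZero (2 * m / 2) := ⟨by omega⟩
  have : NeZero (2 * n / 2) := ⟨by omega⟩
  have : Fact (1 < 2 * m) := ⟨by omega⟩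
  let Y : ℕ → ℕ → (Fin (2 * n) × ZMod (2 * m)) ⊕ (Fin (2 * n / 2) × Fin (2 * m / 2)) :=
    fun s a => Sum.inl (Fin.ofNat _ s, (a : ZMod (2 * m)))
  let X : ℕ → ℕ → (Fin (2 * n) × ZMod (2 * m)) ⊕ (Fin (2 * n / 2) × Fin (2 * m / 2)) :=
    fun s t => Sum.inr (Fin.ofNat _ s, Fin.ofNat _ t)
  have key := abstract_hamiltonian (G := Kgraph (2 * m) (2 * n) k) (Y := Y) (X := X) (n := n)
    (m := m) (by omega) (by omega) ?_ ?_ ?_ ?_ ?_ ?_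
  · convert key
  · simp [ZMod.card, hm, hn]
  · rintro (⟨s, a⟩ | ⟨s, t⟩)
    · refine Or.inl ⟨s, a.val, s.2, ZMod.val_lt a, ?_⟩
      simp [Y]
    · refine Or.inr ⟨s, t, by omega, by omega, ?_⟩
      simp [X]
  · intro s hs a
    simp [Y, Kgraph, SimpleGraph.fromRel_adj]
  · intro s hs
    have := ZMod.natCast_self (2 * m)
    simp only [Y, this, Nat.cast_zero]
  · intro s hs t ht e he f hf
    simp only [X, Y, Kgraph, SimpleGraph.fromRel_adj]
    refine ⟨by simp, Or.inl ⟨?_, ?_⟩⟩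
    · simp only [Fin.val_ofNat, hn, Nat.mod_eq_of_lt hs,
        Nat.mod_eq_of_lt (show 2 * s + e < 2 * n by omega)]
      omega
    · simp only [Fin.val_ofNat, hm, Nat.mod_eq_of_lt ht]
      obtain rfl | rfl : f = 0 ∨ f = 1 := by omega
      · exact Or.inl rfl
      · exact Or.inr rfl
  · intro s hs a
    simp only [Y, Kgraph, SimpleGraph.fromRel_adj]
    have e1 := Nat.mod_eq_of_lt (show 2 * s + 1 < 2 * n by omega)
    have e2 := Nat.mod_eq_of_lt (show 2 * s + 2 < 2 * n by omega)
    refine ⟨fun h => ?_, Or.inl (Or.inr (Or.inl ⟨?_, ?_, trivial⟩))⟩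
    · have := congrArg Fin.val (Prod.ext_iff.mp (Sum.inl.inj h)).1
      simp only [Fin.val_ofNat, e1, e2] at this
      omega
    · simp only [Fin.val_ofNat, e1]
      omega
    · simp only [Fin.val_ofNat, e1, e2]
end
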